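/- Let m ≥ 3 and let A be a traceless symmetric m×m real matrix. Then tr(A³) ≥ -((m-2)/√(m(m-1))) (tr(A²))^{3/2} (Okumura's inequality). -/

import Mathlib

theorem Matrix.IsHermitian.trace_pow_eq_sum_eigenvalues_pow {n : Type*} [Fintype n] [DecidableEq n]
    {A : Matrix n n ℝ} (hA : A.IsHermitian) (k : ℕ) :
    (A ^ k).trace = ∑ i, hA.eigenvalues i ^ k := by
  conv_lhs => rw [hA.spectral_theorem]
  rw [← map_pow, Unitary.conjStarAlgAut_apply, Matrix.trace_mul_cycle, Unitary.coe_star_mul_self,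
    one_mul, Matrix.diagonal_pow, Matrix.trace_diagonal]
  simp

section SumEqZero

variable {ι : Type*} [Fintype ι] {x : ι → ℝ}

theorem card_mul_sq_le_of_sum_eq_zero (hι : 1 < Fintype.card ι) (hx : ∑ i, x i = 0) (i : ι) :
    (Fintype.card ι : ℝ) * x i ^ 2 ≤ ((Fintype.card ι : ℝ) - 1) * ∑ j, x j ^ 2 := by
  set m := (Fintype.card ι : ℝ) with hm
  have hm1 : 0 < m - 1 := by
    have : (1 : ℝ) < m := Nat.one_lt_cast.mpr hι
    linarith
  have hsingle : ((m - 1) * x i + x i) ^ 2 ≤ ∑ j, ((m - 1) * x j + x i) ^ 2 :=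
    Finset.single_le_sum (f := fun j ↦ ((m - 1) * x j + x i) ^ 2)
      (fun j _ ↦ sq_nonneg _) (Finset.mem_univ i)
  have hsum : ∑ j, ((m - 1) * x j + x i) ^ 2 = (m - 1) ^ 2 * ∑ j, x j ^ 2 + m * x i ^ 2 := by
    have h (j : ι) : ((m - 1) * x j + x i) ^ 2
        = (m - 1) ^ 2 * x j ^ 2 + 2 * (m - 1) * x i * x j + x i ^ 2 := by ring
    simp only [h, Finset.sum_add_distrib, ← Finset.mul_sum, hx, Finset.sum_const,
      Finset.card_univ, nsmul_eq_mul, ← hm]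
    ring
  rw [hsum] at hsingle
  refine le_of_mul_le_mul_left ?_ hm1
  linarith

theorem neg_mul_sum_sq_le_sum_cube_of_sum_eq_zero (hι : 1 < Fintype.card ι)
    (hx : ∑ i, x i = 0) {a : ℝ} (ha : 0 ≤ a)
    (hsq : (Fintype.card ι : ℝ) * ((Fintype.card ι : ℝ) - 1) * a ^ 2 = ∑ i, x i ^ 2) :
    -(((Fintype.card ι : ℝ) - 2) * a * ∑ i, x i ^ 2) ≤ ∑ i, x i ^ 3 := by
  have hbound := card_mul_sq_le_of_sum_eq_zero hι hx
  set m := (Fintype.card ι : ℝ) with hm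
  have hm1 : 1 < m := Nat.one_lt_cast.mpr hι
  have hge (i : ι) : 0 ≤ x i + (m - 1) * a := by
    have h : x i ^ 2 ≤ ((m - 1) * a) ^ 2 := by
      refine le_of_mul_le_mul_left ?_ (zero_lt_one.trans hm1)
      linear_combination hbound i - (m - 1) * hsq
    linarith [(abs_le_of_sq_le_sq' h (mul_nonneg (by linarith) ha)).1]
  have hnonneg : 0 ≤ ∑ i, (x i + (m - 1) * a) * (x i - a) ^ 2 :=
    Finset.sum_nonneg fun i _ ↦ mul_nonneg (hge i) (sq_nonneg _)
  have h (i : ι) : (x i + (m - 1) * a) * (x i - a) ^ 2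
      = x i ^ 3 + (m - 3) * a * x i ^ 2 + (3 - 2 * m) * a ^ 2 * x i + (m - 1) * a ^ 3 := by ring
  simp only [h, Finset.sum_add_distrib, ← Finset.mul_sum, hx, Finset.sum_const,
    Finset.card_univ, nsmul_eq_mul, ← hm] at hnonneg
  linear_combination hnonneg + a * hsq

end SumEqZero


/-- Okumura's inequality: if `A` is a traceless symmetric real
`m × m` matrix, `m ≥ 3`, then `tr(A³) ≥ -((m-2)/√(m(m-1))) (tr(A²))^{3/2}`. -/
theorem stmt_12 (m : ℕ) (hm : 3 ≤ m) (A : Matrix (Fin m) (Fin m) ℝ)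
    (hA : A.IsSymm) (htr : A.trace = 0) :
    -(((m : ℝ) - 2) / Real.sqrt ((m : ℝ) * ((m : ℝ) - 1))) *
        ((A ^ 2).trace) ^ ((3 : ℝ) / 2) ≤ (A ^ 3).trace := by
  have hH : A.IsHermitian := by rwa [Matrix.IsHermitian, Matrix.conjTranspose_eq_transpose_of_trivial]
  have hsum : ∑ i, hH.eigenvalues i = 0 := by
    simpa [htr] using (hH.trace_pow_eq_sum_eigenvalues_pow 1).symm
  rw [hH.trace_pow_eq_sum_eigenvalues_pow 2, hH.trace_pow_eq_sum_eigenvalues_pow 3]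
  set S := ∑ i, hH.eigenvalues i ^ 2
  have hS : 0 ≤ S := Finset.sum_nonneg fun i _ ↦ sq_nonneg _
  have hm3 : (3 : ℝ) ≤ m := by exact_mod_cast hm
  have hpos : 0 < (m : ℝ) * (m - 1) := mul_pos (by linarith) (by linarith)
  have hrpow : S ^ ((3 : ℝ) / 2) = S * √S := by
    rw [show (3 : ℝ) / 2 = 1 + 1 / 2 by norm_num, Real.rpow_add_of_nonneg hS (by norm_num)
      (by norm_num), Real.rpow_one, Real.sqrt_eq_rpow]
  have key := neg_mul_sum_sq_le_sum_cube_of_sum_eq_zero (by simp; omega) hsum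
    (a := √S / √((m : ℝ) * (m - 1))) (by positivity) (by
      rw [Fintype.card_fin, div_pow, Real.sq_sqrt hS, Real.sq_sqrt hpos.le,
        mul_div_cancel₀ _ hpos.ne'])
  rw [Fintype.card_fin] at key
  rw [hrpow]
  refine le_of_eq_of_le ?_ key
  ring
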